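/- Fix T > 0, a closed non-trivial rectangle I × J ⊂ (0,T] × ℝ^k, constants N > 0, b > 0, γ̃ > γ > 0, and p > (2d/γ)(γ̃ b - 2k - 4). Then there exists a finite constant C such that for all a ∈ (0, N], ∫_I dt ∫_I ds ∫_J dx ∫_J dy (|t-s|^{γ̃/2} + ‖x-y‖^{γ̃})^{-b/2} · min( (|t-s|^{γ/4} + ‖x-y‖^{γ/2})/a , 1 )^{p/(2d)} ≤ C · K_{(γ̃/γ)b - (4+2k)/γ}(a), where K_α(r) = r^{-α} if α > 0, K_α(r) = log(N₀/r) if α = 0 (for a suitable constant N₀), and K_α(r) = 1 if α < 0. -/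

import Mathlib

open MeasureTheory Real Set
noncomputable section

/-- The kernel `K_α(r)`: `r^{-α}` for `α > 0`, `log(N₀/r)` for `α = 0`, and `1` for `α < 0`. -/
def rieszKernel (N₀ : ℝ) (α : ℝ) (r : ℝ) : ℝ :=
  if 0 < α then r ^ (-α) else if α = 0 then Real.log (N₀ / r) else 1

theorem measure_ext_of_Iic_ne_top {μ ν : Measure ℝ} (hμ : ∀ r, μ (Iic r) ≠ ⊤)
    (h : ∀ r, μ (Iic r) = ν (Iic r)) : μ = ν := by
  refine Measure.ext_of_Ioc' μ ν
    (fun a b _ => ne_top_of_le_ne_top (hμ b) (measure_mono Ioc_subset_Iic_self)) fun a b hab => ?_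
  rw [← Iic_sdiff_Iic, measure_sdiff (Iic_subset_Iic.2 hab.le) nullMeasurableSet_Iic (hμ a),
    measure_sdiff (Iic_subset_Iic.2 hab.le) nullMeasurableSet_Iic (h a ▸ hμ a), h a, h b]

theorem setLIntegral_Ioc_ofReal_mul_pow (n : ℕ) {r : ℝ} (hr : 0 ≤ r) :
    ∫⁻ x in Ioc 0 r, ENNReal.ofReal ((n + 1) * x ^ n) = ENNReal.ofReal (r ^ (n + 1)) := by
  rw [← ofReal_integral_eq_lintegral_ofReal, ← intervalIntegral.integral_of_le hr]
  · rw [intervalIntegral.integral_const_mul, integral_pow]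
    congr 1
    have : (n : ℝ) + 1 ≠ 0 := by positivity
    field_simp
    simp
  · exact ((continuous_const.mul (continuous_pow n)).integrableOn_Icc).mono_set Ioc_subset_Icc_self
  · filter_upwards [ae_restrict_mem measurableSet_Ioc] with x hx
    have := hx.1.le
    positivity

section Polar

variable {E : Type*} [NormedAddCommGroup E] [NormedSpace ℝ E] [FiniteDimensional ℝ E]
  [MeasurableSpace E] [BorelSpace E] (μ : Measure E) [μ.IsAddHaarMeasure]

theorem measurable_parabolic_gauge :
    Measurable fun z : ℝ × E => max (√|z.1|) ‖z.2‖ :=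
  Continuous.measurable (by fun_prop)

theorem measure_parabolic_gauge_le {r : ℝ} (hr : 0 ≤ r) :
    ((volume : Measure ℝ).prod μ) {z | max (√|z.1|) ‖z.2‖ ≤ r} =
      2 * μ (Metric.ball 0 1) * ENNReal.ofReal (r ^ (Module.finrank ℝ E + 2)) := by
  have : {z : ℝ × E | max (√|z.1|) ‖z.2‖ ≤ r} = Icc (-r ^ 2) (r ^ 2) ×ˢ Metric.closedBall 0 r := by
    ext z
    simp [Real.sqrt_le_left hr, abs_le]
  rw [this, Measure.prod_prod, Measure.addHaar_closedBall μ 0 hr, Real.volume_Icc,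
    show r ^ 2 - -r ^ 2 = 2 * r ^ 2 by ring, ENNReal.ofReal_mul zero_le_two, pow_add,
    ENNReal.ofReal_mul (by positivity)]
  simp only [ENNReal.ofReal_ofNat]
  ring

theorem map_parabolic_gauge :
    ((volume : Measure ℝ).prod μ).map (fun z : ℝ × E => max (√|z.1|) ‖z.2‖) =
      (2 * μ (Metric.ball 0 1)) • ((volume.restrict (Ioi 0)).withDensity fun r =>
        ENNReal.ofReal (((Module.finrank ℝ E + 1 : ℕ) + 1) * r ^ (Module.finrank ℝ E + 1))) := by
  have hκ : 2 * μ (Metric.ball 0 1) ≠ ⊤ :=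
    ENNReal.mul_ne_top (by simp) measure_ball_lt_top.ne
  have hl (r : ℝ) : ((volume : Measure ℝ).prod μ).map (fun z : ℝ × E => max (√|z.1|) ‖z.2‖) (Iic r)
      = if 0 ≤ r then 2 * μ (Metric.ball 0 1) * ENNReal.ofReal (r ^ (Module.finrank ℝ E + 2))
        else 0 := by
    rw [Measure.map_apply measurable_parabolic_gauge measurableSet_Iic]
    split_ifs with hr
    · exact measure_parabolic_gauge_le μ hr
    · convert measure_empty (μ := (volume : Measure ℝ).prod μ)
      refine eq_empty_of_forall_notMem fun z hz => hr ?_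
      exact (norm_nonneg z.2).trans ((le_max_right _ _).trans hz)
  refine measure_ext_of_Iic_ne_top (fun r => ?_) fun r => ?_
  · rw [hl]
    split_ifs
    · exact ENNReal.mul_ne_top hκ ENNReal.ofReal_ne_top
    · exact ENNReal.zero_ne_top
  · rw [hl, Measure.smul_apply, withDensity_apply _ measurableSet_Iic,
      Measure.restrict_restrict measurableSet_Iic, inter_comm, Ioi_inter_Iic, smul_eq_mul]
    split_ifs with hr
    · rw [setLIntegral_Ioc_ofReal_mul_pow _ hr]
    · rw [Ioc_eq_empty (fun h => hr h.le)]
      simp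

theorem lintegral_comp_parabolic_gauge {g : ℝ → ENNReal} (hg : Measurable g) :
    ∫⁻ z : ℝ × E, g (max (√|z.1|) ‖z.2‖) ∂((volume : Measure ℝ).prod μ) =
      2 * μ (Metric.ball 0 1) * ∫⁻ r in Ioi 0,
        ENNReal.ofReal (((Module.finrank ℝ E + 1 : ℕ) + 1) * r ^ (Module.finrank ℝ E + 1)) * g r := by
  rw [← lintegral_map hg measurable_parabolic_gauge, map_parabolic_gauge, lintegral_smul_measure,
    lintegral_withDensity_eq_lintegral_mul _ (by fun_prop) hg]
  rfl

/-- Integrating a function of the gauge of `(t - s, x - y)` over all base points. -/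
theorem lintegral_gauge_sub_le {g : ℝ → ENNReal} (hg : Measurable g) (A : Set ℝ) (B : Set E) :
    ∫⁻ t in A, ∫⁻ s in A, ∫⁻ x in B, ∫⁻ y in B, g (max (√|t - s|) ‖x - y‖) ∂μ ∂μ ≤
      volume A * μ B * (2 * μ (Metric.ball 0 1) * ∫⁻ r in Ioi 0,
        ENNReal.ofReal (((Module.finrank ℝ E + 1 : ℕ) + 1) * r ^ (Module.finrank ℝ E + 1)) * g r) := by
  set Φ : ℝ → ENNReal := fun τ => ∫⁻ z, g (max (√|τ|) ‖z‖) ∂μ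
  have hm : Measurable fun z : ℝ × E => g (max (√|z.1|) ‖z.2‖) :=
    hg.comp measurable_parabolic_gauge
  calc _ ≤ ∫⁻ t in A, ∫⁻ s in A, Φ (t - s) * μ B := by
        gcongr with t s
        rw [← setLIntegral_const]
        gcongr with x
        refine (setLIntegral_le_lintegral _ _).trans_eq ?_
        exact lintegral_sub_left_eq_self (fun z => g (max (√|t - s|) ‖z‖)) x
    _ ≤ ∫⁻ t in A, (∫⁻ τ, Φ τ) * μ B := by
        gcongr with t
        refine (setLIntegral_le_lintegral _ _).trans_eq ?_
        rw [lintegral_sub_left_eq_self (fun τ => Φ τ * μ B) t,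
          lintegral_mul_const _ hm.lintegral_prod_right']
    _ = _ := by
        rw [setLIntegral_const, ← lintegral_comp_parabolic_gauge μ hg, lintegral_prod _ hm.aemeasurable]
        ring

end Polar

theorem min_div_one_rpow_le {a w x q : ℝ} (ha : 0 < a) (hw : 0 < w) (hwx : w ≤ x)
    (hxw : x ≤ 2 * w) : (min (x / a) 1) ^ q ≤ 2 ^ |q| * (min (w / a) 1) ^ q := by
  have hm : 0 < min (w / a) 1 := lt_min (by positivity) one_pos
  have hle : min (w / a) 1 ≤ min (x / a) 1 := by gcongr
  rcases le_total 0 q with hq | hq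
  · rw [abs_of_nonneg hq, ← Real.mul_rpow zero_le_two hm.le]
    refine Real.rpow_le_rpow (hm.le.trans hle) ?_ hq
    rw [mul_min_of_nonneg _ _ zero_le_two, ← mul_div_assoc]
    gcongr
    norm_num
  · calc _ ≤ (min (w / a) 1) ^ q := Real.rpow_le_rpow_of_nonpos hm hle hq
      _ ≤ _ := le_mul_of_one_le_left (by positivity)
        (Real.one_le_rpow one_le_two (abs_nonneg q))

theorem integrand_le_gauge {a b c θ q u v : ℝ} (ha : 0 < a) (hb : 0 < b) (hθ : 0 < θ)
    (hu : 0 ≤ u) (hv : 0 ≤ v) (huv : 0 < max u v) :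
    (u ^ c + v ^ c) ^ (-b / 2) * (min ((u ^ θ + v ^ θ) / a) 1) ^ q ≤
      2 ^ |q| * ((max u v) ^ (-(c * b / 2)) * (min ((max u v) ^ θ / a) 1) ^ q) := by
  have hsum (e : ℝ) : (max u v) ^ e ≤ u ^ e + v ^ e := by
    rcases max_choice u v with h | h <;> rw [h]
    · exact le_add_of_nonneg_right (by positivity)
    · exact le_add_of_nonneg_left (by positivity)
  have h1 : (u ^ c + v ^ c) ^ (-b / 2) ≤ (max u v) ^ (-(c * b / 2)) := by
    rw [show -(c * b / 2) = c * (-b / 2) by ring, Real.rpow_mul huv.le]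
    exact Real.rpow_le_rpow_of_nonpos (by positivity) (hsum c) (by linarith)
  have h2 : u ^ θ + v ^ θ ≤ 2 * (max u v) ^ θ := by
    rw [two_mul]
    gcongr
    exacts [le_max_left _ _, le_max_right _ _]
  calc _ ≤ (max u v) ^ (-(c * b / 2)) * (2 ^ |q| * (min ((max u v) ^ θ / a) 1) ^ q) := by
        refine mul_le_mul h1 (min_div_one_rpow_le ha (by positivity) (hsum θ) h2) ?_ ?_ <;> positivity
    _ = _ := by ring

theorem setLIntegral_Ioc_rpow_mul_min_le {a R β θ q : ℝ} (ha : 0 < a) (hθ : 0 < θ)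
    (haR : a ^ (1 / θ) ≤ R) (hδ : 0 < β + θ * q) :
    ∫⁻ r in Ioc 0 R, ENNReal.ofReal (r ^ (β - 1) * (min (r ^ θ / a) 1) ^ q) ≤
      ENNReal.ofReal (a ^ (β / θ) / (β + θ * q) + ∫ r in (a ^ (1 / θ))..R, r ^ (β - 1)) := by
  set r₀ := a ^ (1 / θ) with hr₀
  have hr₀pos : 0 < r₀ := by positivity
  have hpow : r₀ ^ θ = a := by rw [hr₀, ← Real.rpow_mul ha.le, one_div_mul_cancel hθ.ne', Real.rpow_one]
  have hinner : ∫⁻ r in Ioc 0 r₀, ENNReal.ofReal (r ^ (β - 1) * (min (r ^ θ / a) 1) ^ q) =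
      ENNReal.ofReal (a ^ (β / θ) / (β + θ * q)) := by
    have hint : IntervalIntegrable (fun r : ℝ => a ^ (-q) * r ^ (β + θ * q - 1)) volume 0 r₀ :=
      (intervalIntegral.intervalIntegrable_rpow' (by linarith)).const_mul _
    have hval : ∫ r in (0 : ℝ)..r₀, a ^ (-q) * r ^ (β + θ * q - 1) =
        a ^ (β / θ) / (β + θ * q) := by
      rw [intervalIntegral.integral_const_mul, integral_rpow (Or.inl (by linarith)), sub_add_cancel,
        Real.zero_rpow hδ.ne', sub_zero, ← mul_div_assoc, hr₀, ← Real.rpow_mul ha.le,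
        ← Real.rpow_add ha]
      congr 2
      field_simp
      ring
    rw [← hval, intervalIntegral.integral_of_le hr₀pos.le, ofReal_integral_eq_lintegral_ofReal hint.1]
    · refine setLIntegral_congr_fun measurableSet_Ioc fun r hr => ?_
      have hra : r ^ θ / a ≤ 1 := by
        rw [div_le_one ha, ← hpow]
        exact Real.rpow_le_rpow hr.1.le hr.2 hθ.le
      simp only [min_eq_left hra]
      rw [Real.div_rpow (by have := hr.1; positivity) ha.le, ← Real.rpow_mul hr.1.le,
        Real.rpow_neg ha.le, show β + θ * q - 1 = (β - 1) + θ * q by ring, Real.rpow_add hr.1]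
      congr 1
      ring
    · filter_upwards [ae_restrict_mem measurableSet_Ioc] with x hx
      have := hx.1.le
      positivity
  have houter : ∫⁻ r in Ioc r₀ R, ENNReal.ofReal (r ^ (β - 1) * (min (r ^ θ / a) 1) ^ q) =
      ENNReal.ofReal (∫ r in r₀..R, r ^ (β - 1)) := by
    have hint : IntervalIntegrable (fun r : ℝ => r ^ (β - 1)) volume r₀ R :=
      intervalIntegral.intervalIntegrable_rpow
        (Or.inr (notMem_uIcc_of_lt hr₀pos (hr₀pos.trans_le haR)))
    rw [intervalIntegral.integral_of_le haR, ofReal_integral_eq_lintegral_ofReal hint.1]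
    · refine setLIntegral_congr_fun measurableSet_Ioc fun r hr => ?_
      have hra : 1 ≤ r ^ θ / a := by
        rw [one_le_div ha, ← hpow]
        exact Real.rpow_le_rpow hr₀pos.le hr.1.le hθ.le
      simp [min_eq_right hra]
    · filter_upwards [ae_restrict_mem measurableSet_Ioc] with x hx
      have := hr₀pos.trans hx.1
      positivity
  rw [← Ioc_union_Ioc_eq_Ioc hr₀pos.le haR]
  refine (lintegral_union_le _ _ _).trans ?_
  rw [hinner, houter, ENNReal.ofReal_add (by positivity)]
  refine intervalIntegral.integral_nonneg haR fun r hr => ?_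
  have := hr₀pos.trans_le hr.1
  positivity

theorem exists_le_mul_rieszKernel {N R β θ δ : ℝ} (hN : 0 < N) (hR : N ^ (1 / θ) ≤ R)
    (hθ : 0 < θ) (hδ : 0 < δ) :
    ∃ C : ℝ, 0 < C ∧ ∀ a : ℝ, 0 < a → a ≤ N →
      a ^ (β / θ) / δ + ∫ r in (a ^ (1 / θ))..R, r ^ (β - 1) ≤
        C * rieszKernel (exp 1 * R ^ θ) (-(β / θ)) a := by
  have hR0 : 0 < R := lt_of_lt_of_le (by positivity) hR
  have hr (a : ℝ) (ha : 0 < a) : (a ^ (1 / θ)) ^ β = a ^ (β / θ) := by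
    rw [← Real.rpow_mul ha.le, one_div_mul_eq_div]
  have hmem (a : ℝ) (ha : 0 < a) : (0 : ℝ) ∉ uIcc (a ^ (1 / θ)) R :=
    notMem_uIcc_of_lt (by positivity) hR0
  rcases lt_trichotomy β 0 with hβ | rfl | hβ
  · refine ⟨1 / δ + 1 / (-β), add_pos (by positivity) (one_div_pos.2 (neg_pos.2 hβ)), fun a ha _ => ?_⟩
    rw [integral_rpow (Or.inr ⟨by linarith, hmem a ha⟩), sub_add_cancel, hr a ha, rieszKernel,
      if_pos (neg_pos.2 (div_neg_of_neg_of_pos hβ hθ)), neg_neg]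
    have h : (R ^ β - a ^ (β / θ)) / β ≤ a ^ (β / θ) / (-β) := by
      rw [div_neg, ← neg_div, div_le_div_right_of_neg hβ]
      have : 0 ≤ R ^ β := by positivity
      linarith
    calc _ ≤ a ^ (β / θ) / δ + a ^ (β / θ) / (-β) := by gcongr
      _ = _ := by ring
  · refine ⟨1 / δ + 1 / θ, by positivity, fun a ha haN => ?_⟩
    have haR : a ^ (1 / θ) ≤ R := le_trans (by gcongr) hR
    have hI : ∫ r in (a ^ (1 / θ))..R, r ^ ((0 : ℝ) - 1) = log R - log a / θ := by
      simp_rw [zero_sub, Real.rpow_neg_one]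
      rw [integral_inv_of_pos (by positivity) hR0, Real.log_div hR0.ne' (by positivity),
        Real.log_rpow ha]
      ring
    have hpos : 0 ≤ log R - log a / θ := by
      have := Real.log_le_log (by positivity) haR
      rw [Real.log_rpow ha] at this
      rw [div_eq_inv_mul, ← one_div]
      linarith
    rw [hI, rieszKernel, if_neg (by simp), if_pos (by simp),
      Real.log_div (by positivity) ha.ne', Real.log_mul (by positivity) (by positivity),
      Real.log_exp, Real.log_rpow hR0, zero_div, Real.rpow_zero]
    have h1 : 1 + θ * log R - log a = 1 + θ * (log R - log a / θ) := by field_simp; ring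
    rw [h1]
    have h2 : 1 / θ * (θ * (log R - log a / θ)) = log R - log a / θ := by field_simp
    have h3 : 0 ≤ 1 / δ * (θ * (log R - log a / θ)) := by positivity
    have h4 : 0 < 1 / θ := by positivity
    nlinarith
  · refine ⟨N ^ (β / θ) / δ + R ^ β / β, by positivity, fun a ha haN => ?_⟩
    have hα : 0 < β / θ := by positivity
    rw [integral_rpow (Or.inl (by linarith)), sub_add_cancel, rieszKernel,
      if_neg (by linarith), if_neg (by linarith), mul_one]
    gcongr
    exact sub_le_self _ (by positivity)

theorem norm_sub_le_of_mem_box {k : ℕ} {l u : Fin k → ℝ} {x y : EuclideanSpace ℝ (Fin k)}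
    (hx : ∀ i, x i ∈ Icc (l i) (u i)) (hy : ∀ i, y i ∈ Icc (l i) (u i)) :
    ‖x - y‖ ≤ √(∑ i, (u i - l i) ^ 2) := by
  rw [EuclideanSpace.norm_eq]
  gcongr with i
  rw [Real.norm_eq_abs, PiLp.sub_apply, abs_le]
  constructor <;> linarith [(hx i).1, (hx i).2, (hy i).1, (hy i).2]

theorem measurableSet_box {k : ℕ} (l u : Fin k → ℝ) :
    MeasurableSet {x : EuclideanSpace ℝ (Fin k) | ∀ i, x i ∈ Icc (l i) (u i)} := by
  rw [Set.ofPred_forall]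
  exact MeasurableSet.iInter fun i => measurableSet_Icc.preimage (by fun_prop)

theorem volume_box_ne_top {k : ℕ} (l u : Fin k → ℝ) (hlu : ∀ i, l i < u i) :
    volume {x : EuclideanSpace ℝ (Fin k) | ∀ i, x i ∈ Icc (l i) (u i)} ≠ ⊤ := by
  refine ne_top_of_le_ne_top
    (measure_closedBall_lt_top (x := WithLp.toLp 2 l) (r := √(∑ i, (u i - l i) ^ 2))).ne
    (measure_mono fun x hx => ?_)
  rw [mem_closedBall_iff_norm]
  exact norm_sub_le_of_mem_box hx fun i => ⟨le_rfl, (hlu i).le⟩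

/-- The energy integral is controlled by a one-dimensional radial integral. -/
theorem enorm_energy_integral_le {k : ℕ} {t₁ t₂ R : ℝ} {l u : Fin k → ℝ} {a b c θ q : ℝ}
    (hR : √(t₂ - t₁) ≤ R) (hR' : √(∑ i, (u i - l i) ^ 2) ≤ R)
    (ha : 0 < a) (hb : 0 < b) (hθ : 0 < θ) (hc : 0 < c) :
    ‖∫ t in Icc t₁ t₂, ∫ s in Icc t₁ t₂,
        ∫ x in {x : EuclideanSpace ℝ (Fin k) | ∀ i, x i ∈ Icc (l i) (u i)},
        ∫ y in {y : EuclideanSpace ℝ (Fin k) | ∀ i, y i ∈ Icc (l i) (u i)},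
          (|t - s| ^ (c / 2) + ‖x - y‖ ^ c) ^ (-b / 2) *
            (min ((|t - s| ^ (θ / 2) + ‖x - y‖ ^ θ) / a) 1) ^ q‖ₑ ≤
      volume (Icc t₁ t₂) *
        volume {x : EuclideanSpace ℝ (Fin k) | ∀ i, x i ∈ Icc (l i) (u i)} *
        (2 * volume (Metric.ball (0 : EuclideanSpace ℝ (Fin k)) 1) *
          (ENNReal.ofReal ((k + 2) * 2 ^ |q|) * ∫⁻ r in Ioc 0 R,
            ENNReal.ofReal (r ^ ((k + 2 - c * b / 2) - 1) * (min (r ^ θ / a) 1) ^ q))) := by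
  set g : ℝ → ENNReal := (Ioc 0 R).indicator fun r =>
    ENNReal.ofReal (2 ^ |q| * (r ^ (-(c * b / 2)) * (min (r ^ θ / a) 1) ^ q))
  have hg : Measurable g := Measurable.indicator (by fun_prop) measurableSet_Ioc
  have hbox := measurableSet_box l u
  have key : ∀ t ∈ Icc t₁ t₂, ∀ s ∈ Icc t₁ t₂,
      ∀ x ∈ {x : EuclideanSpace ℝ (Fin k) | ∀ i, x i ∈ Icc (l i) (u i)},
      ∀ y ∈ {x : EuclideanSpace ℝ (Fin k) | ∀ i, x i ∈ Icc (l i) (u i)},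
      ‖(|t - s| ^ (c / 2) + ‖x - y‖ ^ c) ^ (-b / 2) *
            (min ((|t - s| ^ (θ / 2) + ‖x - y‖ ^ θ) / a) 1) ^ q‖ₑ ≤
        g (max (√|t - s|) ‖x - y‖) := by
    intro t ht s hs x hx y hy
    have hsq (e : ℝ) : |t - s| ^ (e / 2) = √|t - s| ^ e := by
      rw [Real.sqrt_eq_rpow, ← Real.rpow_mul (abs_nonneg _)]
      congr 1
      ring
    rw [hsq, hsq, Real.enorm_of_nonneg (by positivity)]
    rcases (le_max_of_le_right (norm_nonneg (x - y)) : 0 ≤ max (√|t - s|) ‖x - y‖).eq_or_lt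
      with h0 | hpos
    · have h1 : √|t - s| = 0 := le_antisymm (h0 ▸ le_max_left _ _) (Real.sqrt_nonneg _)
      have h2 : ‖x - y‖ = 0 := le_antisymm (h0 ▸ le_max_right _ _) (norm_nonneg _)
      rw [h1, h2, Real.zero_rpow hc.ne', add_zero, Real.zero_rpow (by linarith), zero_mul,
        ENNReal.ofReal_zero]
      exact zero_le
    · have hle : max (√|t - s|) ‖x - y‖ ≤ R := by
        refine max_le ((Real.sqrt_le_sqrt ?_).trans hR) ((norm_sub_le_of_mem_box hx hy).trans hR')
        rw [abs_le]
        constructor <;> linarith [ht.1, ht.2, hs.1, hs.2]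
      simp only [g, indicator_of_mem (show max (√|t - s|) ‖x - y‖ ∈ Ioc 0 R from ⟨hpos, hle⟩)]
      exact ENNReal.ofReal_le_ofReal
        (integrand_le_gauge ha hb hθ (Real.sqrt_nonneg _) (norm_nonneg _) hpos)
  calc _ ≤ ∫⁻ t in Icc t₁ t₂, ∫⁻ s in Icc t₁ t₂,
        ∫⁻ x in {x : EuclideanSpace ℝ (Fin k) | ∀ i, x i ∈ Icc (l i) (u i)},
        ∫⁻ y in {y : EuclideanSpace ℝ (Fin k) | ∀ i, y i ∈ Icc (l i) (u i)},
          g (max (√|t - s|) ‖x - y‖) := by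
        refine (enorm_integral_le_lintegral_enorm _).trans
          (setLIntegral_mono' measurableSet_Icc fun t ht => ?_)
        refine (enorm_integral_le_lintegral_enorm _).trans
          (setLIntegral_mono' measurableSet_Icc fun s hs => ?_)
        refine (enorm_integral_le_lintegral_enorm _).trans
          (setLIntegral_mono' hbox fun x hx => ?_)
        exact (enorm_integral_le_lintegral_enorm _).trans
          (setLIntegral_mono' hbox fun y hy => key t ht s hs x hx y hy)
    _ ≤ _ := lintegral_gauge_sub_le volume hg _ _
    _ = _ := by
        rw [finrank_euclideanSpace_fin, ← lintegral_const_mul' _ _ ENNReal.ofReal_ne_top]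
        congr 2
        rw [← Ioi_inter_Iic, inter_comm, ← Measure.restrict_restrict measurableSet_Iic,
          ← lintegral_indicator measurableSet_Iic]
        refine setLIntegral_congr_fun measurableSet_Ioi fun r hr => ?_
        have hr' : 0 < r := hr
        by_cases hrR : r ≤ R
        · simp only [g, indicator_of_mem (show r ∈ Ioc 0 R from ⟨hr, hrR⟩),
            indicator_of_mem (show r ∈ Iic R from hrR)]
          rw [← ENNReal.ofReal_mul (by positivity), ← ENNReal.ofReal_mul (by positivity),
            show (k + 2 - c * b / 2) - 1 = ((k + 1 : ℕ) : ℝ) + -(c * b / 2) by push_cast; ring,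
            Real.rpow_add hr', Real.rpow_natCast]
          congr 1
          push_cast
          ring
        · simp [g, hrR]

/-- Lemma 2.2: for a closed non-trivial rectangle `I × J ⊂ (0,T] × ℝ^k`, `N > 0`, `b > 0`,
`γ̃ > γ > 0` and `p > (2d/γ)(γ̃ b - 2k - 4)`, there are `N₀` and `C > 0` such that for
all `a ∈ (0, N]`,
`∫_I∫_I∫_J∫_J (|t-s|^{γ̃/2}+‖x-y‖^{γ̃})^{-b/2} min((|t-s|^{γ/4}+‖x-y‖^{γ/2})/a, 1)^{p/(2d)}
≤ C K_{(γ̃/γ)b - (4+2k)/γ}(a)`. -/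
theorem energy_integral_bound (k d : ℕ) (hk : 1 ≤ k) (hd : 1 ≤ d)
    (T t₁ t₂ : ℝ) (hT : 0 < T) (ht₁ : 0 < t₁) (ht₁₂ : t₁ < t₂) (ht₂ : t₂ ≤ T)
    (aJ bJ : Fin k → ℝ) (hJ : ∀ i, aJ i < bJ i)
    (N b γ γ' p : ℝ) (hN : 0 < N) (hb : 0 < b) (hγ : 0 < γ) (hγγ' : γ < γ')
    (hp : (2 * (d : ℝ) / γ) * (γ' * b - 2 * (k : ℝ) - 4) < p) :
    ∃ N₀ C : ℝ, 0 < C ∧ ∀ a : ℝ, 0 < a → a ≤ N →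
      (∫ t in Set.Icc t₁ t₂, ∫ s in Set.Icc t₁ t₂,
        ∫ x in {x : EuclideanSpace ℝ (Fin k) | ∀ i, x i ∈ Set.Icc (aJ i) (bJ i)},
        ∫ y in {y : EuclideanSpace ℝ (Fin k) | ∀ i, y i ∈ Set.Icc (aJ i) (bJ i)},
          (|t - s| ^ (γ' / 2) + ‖x - y‖ ^ γ') ^ (-b / 2) *
            (min ((|t - s| ^ (γ / 4) + ‖x - y‖ ^ (γ / 2)) / a) 1) ^ (p / (2 * (d : ℝ))))
        ≤ C * rieszKernel N₀ ((γ' / γ) * b - (4 + 2 * (k : ℝ)) / γ) a := by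
  have hd' : (0 : ℝ) < d := by exact_mod_cast hd
  have hγ' : 0 < γ' := hγ.trans hγγ'
  set q := p / (2 * (d : ℝ)) with hq
  set β : ℝ := k + 2 - γ' * b / 2 with hβ
  set R := √(t₂ - t₁) + √(∑ i, (bJ i - aJ i) ^ 2) + N ^ (1 / (γ / 2)) with hRdef
  have hδ : 0 < β + γ / 2 * q := by
    have h : γ' * b - 2 * k - 4 < γ * q := by
      rw [hq, mul_div_assoc', lt_div_iff₀ (by positivity)]
      rw [div_mul_eq_mul_div, div_lt_iff₀ hγ] at hp
      linarith
    linarith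
  have hNR : N ^ (1 / (γ / 2)) ≤ R := le_add_of_nonneg_left (by positivity)
  have hN0 : 0 ≤ N ^ (1 / (γ / 2)) := by positivity
  have hR1 : √(t₂ - t₁) ≤ R := by
    linarith [Real.sqrt_nonneg (∑ i, (bJ i - aJ i) ^ 2)]
  have hR2 : √(∑ i, (bJ i - aJ i) ^ 2) ≤ R := by
    linarith [Real.sqrt_nonneg (t₂ - t₁)]
  obtain ⟨C, hC, hCK⟩ := exists_le_mul_rieszKernel (β := β) hN hNR (half_pos hγ) hδ
  set M : ENNReal := volume (Icc t₁ t₂) *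
    volume {x : EuclideanSpace ℝ (Fin k) | ∀ i, x i ∈ Icc (aJ i) (bJ i)} *
    (2 * volume (Metric.ball (0 : EuclideanSpace ℝ (Fin k)) 1) *
      ENNReal.ofReal ((k + 2) * 2 ^ |q|)) with hM
  have hMtop : M ≠ ⊤ :=
    ENNReal.mul_ne_top (ENNReal.mul_ne_top measure_Icc_lt_top.ne (volume_box_ne_top _ _ hJ))
      (ENNReal.mul_ne_top (ENNReal.mul_ne_top (by simp) measure_ball_lt_top.ne)
        ENNReal.ofReal_ne_top)
  refine ⟨exp 1 * R ^ (γ / 2), (M.toReal + 1) * C, by positivity, fun a ha haN => ?_⟩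
  have haR : a ^ (1 / (γ / 2)) ≤ R := le_trans (by gcongr) hNR
  have hα : γ' / γ * b - (4 + 2 * (k : ℝ)) / γ = -(β / (γ / 2)) := by
    rw [hβ]
    field_simp
    ring
  have hX := hCK a ha haN
  have hX0 : 0 ≤ a ^ (β / (γ / 2)) / (β + γ / 2 * q) +
      ∫ r in (a ^ (1 / (γ / 2)))..R, r ^ (β - 1) := by
    refine add_nonneg (by positivity) (intervalIntegral.integral_nonneg haR fun r hr => ?_)
    have : 0 ≤ r := le_trans (by positivity) hr.1
    positivity
  rw [hα, show γ / 4 = γ / 2 / 2 by ring]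
  have hle := (enorm_energy_integral_le (q := q) hR1 hR2 ha hb (half_pos hγ) hγ').trans
    (mul_le_mul_right (mul_le_mul_right (mul_le_mul_right
      (setLIntegral_Ioc_rpow_mul_min_le ha (half_pos hγ) haR hδ) _) _) _)
  rw [← mul_assoc (2 * _), ← mul_assoc, ← hM, ← ENNReal.ofReal_toReal hMtop,
    ← ENNReal.ofReal_mul ENNReal.toReal_nonneg, Real.enorm_eq_ofReal_abs,
    ENNReal.ofReal_le_ofReal_iff (by positivity)] at hle
  refine (le_abs_self _).trans (hle.trans ?_)
  rw [mul_assoc]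
  exact mul_le_mul (by linarith) hX hX0 (by positivity)
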